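/- Let ρ₁ : ℝ → ℝ be continuous, nonnegative, vanishing outside the open interval (1/2,1), and satisfying ∫_0^1 r³·ρ₁(r) dr = c for some c > 0. Define ρ : (0,1] → ℝ by ρ(r) = Σ_{k≥1} 2^{4(k−1)}·ρ₁(2^{k−1}·r) (for each r at most one summand is nonzero, namely the one with 2^{−k} < r < 2^{−(k−1)}). Then: (a) ρ is continuous on (0,1]; (b) for every k ≥ 1, ∫_0^1 r³·2^{4(k−1)}·ρ₁(2^{k−1} r) dr = c; and (c) the function r ↦ r³·ρ(r) is not Lebesgue-integrable on (0,1), i.e., ∫_0^1 r³·ρ(r) dr = +∞. -/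

import Mathlib

open MeasureTheory intervalIntegral

lemma dyadic_eq_zero {f : ℝ → ℝ} (hf : ∀ r, 1 ≤ r → f r = 0) {a r : ℝ} {N k : ℕ}
    (ha : 0 < a) (hN : 1 ≤ 2 ^ N * a) (har : a ≤ r) (hk : N ≤ k) :
    2 ^ (4 * k) * f (2 ^ k * r) = 0 := by
  have h : (1 : ℝ) ≤ 2 ^ k * r := hN.trans (by gcongr; norm_num)
  rw [hf _ h, mul_zero]

/-- On a half-line `[a, ∞)` with `2 ^ N * a ≥ 1`, only the first `N` dyadic rescalings of a function
vanishing on `[1, ∞)` contribute to the sum. -/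
lemma tsum_dyadic_eq_sum_range {f : ℝ → ℝ} (hf : ∀ r, 1 ≤ r → f r = 0) {a r : ℝ} {N : ℕ}
    (ha : 0 < a) (hN : 1 ≤ 2 ^ N * a) (har : a ≤ r) :
    ∑' k : ℕ, 2 ^ (4 * k) * f (2 ^ k * r) =
      ∑ k ∈ Finset.range N, 2 ^ (4 * k) * f (2 ^ k * r) :=
  tsum_eq_sum fun k hk => dyadic_eq_zero hf ha hN har (by simpa using hk)

/-- Every positive real is moved beyond `1` by a power of two. -/
lemma exists_one_le_two_pow_mul {a : ℝ} (ha : 0 < a) : ∃ N : ℕ, 1 ≤ 2 ^ N * a := by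
  obtain ⟨N, hN⟩ := pow_unbounded_of_one_lt a⁻¹ (one_lt_two : (1 : ℝ) < 2)
  exact ⟨N, ((inv_lt_iff_one_lt_mul₀ ha).1 hN).le⟩

lemma continuousOn_tsum_dyadic {f : ℝ → ℝ} (hcont : Continuous f) (hf : ∀ r, 1 ≤ r → f r = 0) :
    ContinuousOn (fun r => ∑' k : ℕ, 2 ^ (4 * k) * f (2 ^ k * r)) (Set.Ioi 0) := by
  intro r hr
  have hr : 0 < r := hr
  obtain ⟨N, hN⟩ := exists_one_le_two_pow_mul (half_pos hr)
  have h : Continuous fun r => ∑ k ∈ Finset.range N, 2 ^ (4 * k) * f (2 ^ k * r) := by fun_prop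
  refine (h.continuousAt.congr ?_).continuousWithinAt
  filter_upwards [lt_mem_nhds (half_lt_self hr)] with x hx
  exact (tsum_dyadic_eq_sum_range hf (half_pos hr) hN hx.le).symm

lemma summable_dyadic {f : ℝ → ℝ} (hf : ∀ r, 1 ≤ r → f r = 0) {r : ℝ} (hr : 0 < r) :
    Summable fun k : ℕ => 2 ^ (4 * k) * f (2 ^ k * r) := by
  obtain ⟨N, hN⟩ := exists_one_le_two_pow_mul hr
  exact summable_of_ne_finset_zero (s := Finset.range N) fun k hk =>
    dyadic_eq_zero hf hr hN le_rfl (by simpa using hk)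

/-- The rescaling `r ↦ 2 ^ (4 * k) * f (2 ^ k * r)` preserves the integral against `r ^ 3`. -/
lemma integral_cube_mul_dyadic {f : ℝ → ℝ} (hcont : Continuous f) (hf : ∀ r, 1 ≤ r → f r = 0)
    (k : ℕ) :
    ∫ r in (0:ℝ)..1, r ^ 3 * (2 ^ (4 * k) * f (2 ^ k * r)) = ∫ r in (0:ℝ)..1, r ^ 3 * f r := by
  have hg : Continuous fun r : ℝ => r ^ 3 * f r := by fun_prop
  have hscale : ∀ r : ℝ, r ^ 3 * (2 ^ (4 * k) * f (2 ^ k * r)) =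
      2 ^ k * ((2 ^ k * r) ^ 3 * f (2 ^ k * r)) := fun r => by ring
  have htail : ∫ r in (1:ℝ)..2 ^ k, r ^ 3 * f r = 0 := by
    refine integral_zero_ae (Filter.Eventually.of_forall fun r hr => ?_)
    rw [Set.uIoc_of_le (one_le_pow₀ one_le_two)] at hr
    rw [hf r hr.1.le, mul_zero]
  simp_rw [hscale]
  rw [intervalIntegral.integral_const_mul,
    mul_integral_comp_mul_left (f := fun r : ℝ => r ^ 3 * f r), mul_zero, mul_one,
    ← integral_add_adjacent_intervals (hg.intervalIntegrable 0 1)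
      (hg.intervalIntegrable 1 (2 ^ k)), htail, add_zero]

lemma lintegral_cube_mul_tsum_dyadic_eq_top {f : ℝ → ℝ} (hcont : Continuous f)
    (hnonneg : ∀ r, 0 ≤ f r) (hf : ∀ r, 1 ≤ r → f r = 0)
    (hpos : 0 < ∫ r in (0:ℝ)..1, r ^ 3 * f r) :
    ∫⁻ r in Set.Ioo (0:ℝ) 1,
      ENNReal.ofReal (r ^ 3 * ∑' k : ℕ, 2 ^ (4 * k) * f (2 ^ k * r)) = ⊤ := by
  have hterm : ∀ k : ℕ, Continuous fun r : ℝ => r ^ 3 * (2 ^ (4 * k) * f (2 ^ k * r)) :=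
    fun k => by fun_prop
  have hterm_nonneg : ∀ k : ℕ, ∀ r : ℝ, 0 < r → 0 ≤ r ^ 3 * (2 ^ (4 * k) * f (2 ^ k * r)) :=
    fun k r hr => mul_nonneg (by positivity) (mul_nonneg (by positivity) (hnonneg _))
  have hpiece : ∀ k : ℕ, ∫⁻ r in Set.Ioo (0:ℝ) 1,
      ENNReal.ofReal (r ^ 3 * (2 ^ (4 * k) * f (2 ^ k * r))) =
        ENNReal.ofReal (∫ r in (0:ℝ)..1, r ^ 3 * f r) := by
    intro k
    rw [← integral_cube_mul_dyadic hcont hf k, integral_of_le zero_le_one,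
      integral_Ioc_eq_integral_Ioo, ofReal_integral_eq_lintegral_ofReal]
    · exact (hterm k).integrableOn_Icc.mono_set Set.Ioo_subset_Icc_self
    · filter_upwards [ae_restrict_mem measurableSet_Ioo] with r hr
      exact hterm_nonneg k r hr.1
  calc
    _ = ∫⁻ r in Set.Ioo (0:ℝ) 1,
        ∑' k : ℕ, ENNReal.ofReal (r ^ 3 * (2 ^ (4 * k) * f (2 ^ k * r))) := by
      refine setLIntegral_congr_fun measurableSet_Ioo fun r hr => ?_
      rw [← tsum_mul_left]
      exact ENNReal.ofReal_tsum_of_nonneg (fun k => hterm_nonneg k r hr.1)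
        ((summable_dyadic hf hr.1).mul_left _)
    _ = ∑' k : ℕ, ∫⁻ r in Set.Ioo (0:ℝ) 1,
        ENNReal.ofReal (r ^ 3 * (2 ^ (4 * k) * f (2 ^ k * r))) :=
      lintegral_tsum fun k => (hterm k).measurable.ennreal_ofReal.aemeasurable
    _ = ⊤ := by
      simp_rw [hpiece]
      exact ENNReal.tsum_const_eq_top_of_ne_zero (by simpa using hpos)

/-- Let `ρ₁ : ℝ → ℝ` be continuous, nonnegative, vanishing outside `(1/2,1)`, with
`∫_0^1 r³·ρ₁(r) dr = c > 0`. Define `ρ(r) = Σ_{k≥1} 2^{4(k−1)}·ρ₁(2^{k−1}·r)`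
(indexed below by `k : ℕ` as `Σ_k 2^{4k}·ρ₁(2^k·r)`). Then:
(a) `ρ` is continuous on `(0,1]`;
(b) each summand contributes Calabi integral `∫_0^1 r³·2^{4k}·ρ₁(2^k r) dr = c`;
(c) `r ↦ r³·ρ(r)` is not Lebesgue-integrable on `(0,1)`: `∫_0^1 r³·ρ(r) dr = +∞`. -/
theorem wild_twist_hamiltonian (ρ₁ : ℝ → ℝ)
    (hcont : Continuous ρ₁) (hnonneg : ∀ r, 0 ≤ ρ₁ r)
    (hsupp : ∀ r : ℝ, r ∉ Set.Ioo (1/2 : ℝ) 1 → ρ₁ r = 0)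
    (c : ℝ) (hc : 0 < c)
    (hcal : ∫ r in (0:ℝ)..1, r^3 * ρ₁ r = c)
    (ρ : ℝ → ℝ)
    (hρ : ∀ r : ℝ, ρ r = ∑' k : ℕ, 2^(4*k) * ρ₁ (2^k * r)) :
    ContinuousOn ρ (Set.Ioc (0:ℝ) 1) ∧
    (∀ k : ℕ, ∫ r in (0:ℝ)..1, r^3 * (2^(4*k) * ρ₁ (2^k * r)) = c) ∧
    (¬ IntegrableOn (fun r => r^3 * ρ r) (Set.Ioo (0:ℝ) 1)) ∧
    ∫⁻ r in Set.Ioo (0:ℝ) 1, ENNReal.ofReal (r^3 * ρ r) = ⊤ := by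
  have hf : ∀ r, 1 ≤ r → ρ₁ r = 0 := fun r hr => hsupp r fun h => absurd h.2 hr.not_gt
  obtain rfl : ρ = fun r => ∑' k : ℕ, 2 ^ (4 * k) * ρ₁ (2 ^ k * r) := funext hρ
  have htop := lintegral_cube_mul_tsum_dyadic_eq_top hcont hnonneg hf (hcal ▸ hc)
  exact ⟨(continuousOn_tsum_dyadic hcont hf).mono fun r hr => hr.1,
    fun k => (integral_cube_mul_dyadic hcont hf k).trans hcal,
    fun h => h.lintegral_lt_top.ne htop, htop⟩
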